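/- For every Boolean function f ∈ B_10, the second-order nonlinearity satisfies nl_2(f) ≤ 460; that is, the covering radius of RM(2,10) is at most 460. -/

import Mathlib

open scoped BigOperators

/-- Boolean functions in `n` variables. -/
abbrev BF (n : ℕ) := (Fin n → ZMod 2) → ZMod 2

/-- Hamming distance between two Boolean functions. -/
def hd {n : ℕ} (f g : BF n) : ℕ :=
  (Finset.univ.filter (fun x : Fin n → ZMod 2 => f x ≠ g x)).card

/-- The Reed--Muller code `RM(r,n)`: Boolean functions given by evaluation of a
multivariate polynomial over `F_2` of total degree at most `r`. -/
def RM (r n : ℕ) : Set (BF n) :=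
  {f | ∃ p : MvPolynomial (Fin n) (ZMod 2),
    p.totalDegree ≤ r ∧ ∀ x, f x = MvPolynomial.eval x p}

/-- The `r`-th order nonlinearity of a Boolean function. -/
noncomputable def nl (r : ℕ) {n : ℕ} (f : BF n) : ℕ :=
  sInf {d | ∃ g ∈ RM r n, d = hd f g}

/-- Concatenation `f1 || f2` of two Boolean functions. -/
def concat {n : ℕ} (f1 f2 : BF n) : BF (n + 1) :=
  fun x => (1 + x (Fin.last n)) * f1 (x ∘ Fin.castSucc)
    + x (Fin.last n) * f2 (x ∘ Fin.castSucc)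

/-- A Boolean function is homogeneous quadratic if it is of the form
`∑_{i<j} a_{ij} x_i x_j`. -/
def HomQuad {n : ℕ} (g : BF n) : Prop :=
  ∃ a : Fin n → Fin n → ZMod 2,
    ∀ x, g x = ∑ i : Fin n, ∑ j : Fin n, (if i < j then a i j * x i * x j else 0)

/-- `Fh f r` is the set of homogeneous quadratic functions `g` with `nl(f+g) = r`. -/
def Fh {n : ℕ} (f : BF n) (r : ℕ) : Set (BF n) :=
  {g | HomQuad g ∧ nl 1 (f + g) = r}

/-- `NFh f r = |Fh f r|`. -/
noncomputable def NFh {n : ℕ} (f : BF n) (r : ℕ) : ℕ := (Fh f r).ncard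

/-- The set of 6-variable Boolean functions with nonlinearity 16. -/
def S16 : Set (BF 6) := {f | nl 1 f = 16}

/-- `f1` and `f2` are affine equivalent modulo `RM(r,n)`. -/
def AffEquivMod (r n : ℕ) (f1 f2 : BF n) : Prop :=
  ∃ A : Matrix (Fin n) (Fin n) (ZMod 2), IsUnit A ∧ ∃ b : Fin n → ZMod 2,
    (fun x => f1 x + f2 (A.mulVec x + b)) ∈ RM r n

def fun1 : BF 6 := fun x => x 0*x 1*x 5 + x 0*x 2*x 4 + x 1*x 2*x 3

def fun2 : BF 6 := fun x => x 0*x 1*x 2*x 3 + x 0*x 1*x 5 + x 0*x 3*x 4 + x 1*x 2*x 4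

def fun3 : BF 6 := fun x => x 0*x 1*x 2*x 3 + x 0*x 2*x 4 + x 0*x 3*x 5 + x 1*x 2*x 4
  + x 1*x 2*x 5 + x 1*x 3*x 4

def fun4 : BF 6 := fun x => x 0*x 1*x 2*x 5 + x 0*x 1*x 3*x 4 + x 0*x 2*x 4
  + x 0*x 3*x 4 + x 0*x 3*x 5 + x 1*x 2*x 3

def fun5 : BF 6 := fun x => x 0*x 1*x 2*x 3*x 4 + x 0*x 2*x 4 + x 0*x 3*x 5
  + x 1*x 2*x 4 + x 1*x 2*x 5 + x 1*x 3*x 4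

def fun6 : BF 6 := fun x => x 0*x 1*x 2*x 3*x 4*x 5 + x 0*x 1*x 5 + x 0*x 2*x 4
  + x 1*x 2*x 3

def fun7 : BF 6 := fun x => x 0*x 1*x 2*x 3*x 4*x 5 + x 0*x 1*x 2*x 3 + x 0*x 1*x 5
  + x 0*x 3*x 4 + x 1*x 2*x 4 + x 3*x 4

def fun8 : BF 6 := fun x => x 0*x 1*x 2*x 3*x 4*x 5 + x 0*x 1*x 2*x 3 + x 0*x 2*x 4
  + x 0*x 3*x 5 + x 1*x 2*x 4 + x 1*x 2*x 5 + x 1*x 3*x 4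

def fun9 : BF 6 := fun x => x 0*x 1*x 2*x 3*x 4*x 5 + x 0*x 1*x 2*x 5 + x 0*x 1*x 3*x 4
  + x 0*x 2*x 4 + x 0*x 3*x 4 + x 0*x 3*x 5 + x 1*x 2*x 3 + x 3*x 5

def fun10 : BF 6 := fun x => x 0*x 1*x 2*x 3*x 4*x 5 + x 0*x 1*x 2*x 3 + x 0*x 2*x 3
  + x 0*x 4*x 5 + x 1*x 2*x 3 + x 1*x 2*x 5 + x 1*x 3*x 4 + x 2*x 3 + x 2*x 5 + x 3*x 4

def fun11 : BF 6 := fun x => x 0*x 1*x 2*x 3*x 4*x 5 + x 0*x 1*x 2*x 5 + x 0*x 1*x 3*x 4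
  + x 0*x 2*x 4 + x 0*x 3*x 4 + x 0*x 3*x 5 + x 1*x 2*x 3 + x 1*x 2*x 5 + x 1*x 3*x 4
  + x 2*x 4 + x 3*x 4 + x 3*x 5

def fun12 : BF 6 := fun x => x 0*x 1*x 2*x 3*x 4*x 5 + x 1*x 2*x 3*x 4 + x 0*x 1*x 4*x 5
  + x 0*x 2*x 3*x 5 + x 0*x 1*x 3 + x 0*x 1*x 4 + x 1*x 2*x 4 + x 2*x 3*x 4
  + x 0*x 1*x 5 + x 2*x 3*x 5

def g0 : BF 6 := fun x => x 0*x 1*x 2 + x 0*x 3*x 4 + x 1*x 3*x 5 + x 2*x 4*x 5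
  + x 3*x 4*x 5


/-- The affine function `x ↦ l · x + c`. -/
def affFun {n : ℕ} (l : Fin n → ZMod 2) (c : ZMod 2) : BF n := fun x => ∑ i, l i * x i + c

/-- Affine Boolean functions. -/
def IsAff {n : ℕ} (h : BF n) : Prop := ∃ l c, h = affFun l c

/-- Coefficients (with redundancy) of Boolean functions of degree at most two. -/
abbrev QuadCoeff (n : ℕ) := (Fin n → Fin n → ZMod 2) × (Fin n → ZMod 2) × ZMod 2

/-- The Boolean function of degree at most two with the given coefficients. -/
def quadFun {n : ℕ} (p : QuadCoeff n) : BF n :=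
  fun x => ∑ i, ∑ j, p.1 i j * (x i * x j) + ∑ i, p.2.1 i * x i + p.2.2

/-- A set of points orthogonal to all functions of degree at most two. -/
def QOrth {n : ℕ} (A : Finset (Fin n → ZMod 2)) : Prop :=
  ∀ p : QuadCoeff n, ∑ x ∈ A, quadFun p x = 0

/-- The number of points of `A` where `h` takes the value one. -/
def wt {n : ℕ} (A : Finset (Fin n → ZMod 2)) (h : BF n) : ℕ := ∑ x ∈ A, (h x).val

lemma zmod2_cases (a : ZMod 2) : a = 0 ∨ a = 1 := by
  revert a; decide

section Affine

variable {n : ℕ}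

lemma IsAff.add {h k : BF n} (hh : IsAff h) (hk : IsAff k) : IsAff (h + k) := by
  obtain ⟨l, c, rfl⟩ := hh
  obtain ⟨l', c', rfl⟩ := hk
  refine ⟨l + l', c + c', ?_⟩
  funext x
  simp only [affFun, Pi.add_apply, add_mul, Finset.sum_add_distrib]
  ring

lemma isAff_one : IsAff (1 : BF n) := ⟨0, 1, by funext x; simp [affFun]⟩

lemma isAff_coord (i : Fin n) : IsAff (fun x : Fin n → ZMod 2 => x i) :=
  ⟨Pi.single i 1, 0, by funext x; simp [affFun, Pi.single_apply]⟩

lemma isAff_dual (φ : Module.Dual (ZMod 2) (Fin n → ZMod 2)) : IsAff (fun x => φ x) := by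
  refine ⟨fun i => φ (fun j => if i = j then 1 else 0), 0, ?_⟩
  funext x
  rw [LinearMap.pi_apply_eq_sum_univ φ x]
  simp [affFun, mul_comm]

lemma exists_isAff_separating {x y : Fin n → ZMod 2} (hxy : x ≠ y) :
    ∃ h : BF n, IsAff h ∧ h x = 1 ∧ h y = 0 := by
  obtain ⟨i, hi⟩ := Function.ne_iff.mp hxy
  rcases zmod2_cases (x i) with h0 | h0 <;> rcases zmod2_cases (y i) with h1 | h1
  · exact absurd (h0.trans h1.symm) hi
  · exact ⟨_, (isAff_coord i).add isAff_one, by simp [h0], by simp [h1]; decide⟩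
  · exact ⟨_, isAff_coord i, h0, h1⟩
  · exact absurd (h0.trans h1.symm) hi

lemma exists_isAff_separating_plane {x y z a : Fin n → ZMod 2} (hx : a ≠ x) (hy : a ≠ y)
    (hz : a ≠ z) (hs : a ≠ x + y + z) :
    ∃ h : BF n, IsAff h ∧ h x = 1 ∧ h y = 1 ∧ h z = 1 ∧ h a = 0 := by
  have hself : ∀ v : Fin n → ZMod 2, v + v = 0 := fun v => by
    funext i; exact CharTwo.add_self_eq_zero (v i)
  have key : a + x ∉ Submodule.span (ZMod 2) ({y + x, z + x} : Set (Fin n → ZMod 2)) := by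
    rw [Submodule.mem_span_pair]
    rintro ⟨c, d, hcd⟩
    have ha : a = c • (y + x) + d • (z + x) + x := by
      rw [hcd, add_assoc, hself, add_zero]
    rcases zmod2_cases c with rfl | rfl <;> rcases zmod2_cases d with rfl | rfl
    · exact hx (by simpa using ha)
    · exact hz (by rw [ha]; simp [add_assoc, hself])
    · exact hy (by rw [ha]; simp [add_assoc, hself])
    · refine hs (ha.trans ?_)
      rw [one_smul, one_smul, show y + x + (z + x) + x = x + y + z + (x + x) by abel, hself,
        add_zero]
  obtain ⟨φ, hφa, hφ⟩ := Submodule.exists_le_ker_of_notMem key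
  have h1 : φ y + φ x = 0 := by
    rw [← map_add]; exact hφ (Submodule.subset_span (by simp))
  have h2 : φ z + φ x = 0 := by
    rw [← map_add]; exact hφ (Submodule.subset_span (by simp))
  rw [map_add] at hφa
  have haff := isAff_dual φ
  rcases zmod2_cases (φ x) with h0 | h0
  · refine ⟨_, haff.add isAff_one, ?_⟩
    simp only [Pi.add_apply, Pi.one_apply]
    revert h0 h1 h2 hφa
    generalize φ x = a0; generalize φ y = a1; generalize φ z = a2; generalize φ a = a3
    revert a0 a1 a2 a3; decide
  · refine ⟨_, haff, ?_⟩
    revert h0 h1 h2 hφa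
    generalize φ x = a0; generalize φ y = a1; generalize φ z = a2; generalize φ a = a3
    revert a0 a1 a2 a3; decide

end Affine

section Weight

variable {n : ℕ} {A : Finset (Fin n → ZMod 2)}

lemma wt_add (h k : BF n) : wt A (h + k) + 2 * wt A (h * k) = wt A h + wt A k := by
  simp only [wt, Finset.mul_sum, ← Finset.sum_add_distrib]
  refine Finset.sum_congr rfl fun x _ => ?_
  simp only [Pi.add_apply, Pi.mul_apply]
  generalize h x = a; generalize k x = b; revert a b; decide

lemma wt_mul_split (h k : BF n) : wt A (h * k) + wt A (h * (k + 1)) = wt A h := by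
  simp only [wt, ← Finset.sum_add_distrib]
  refine Finset.sum_congr rfl fun x _ => ?_
  simp only [Pi.add_apply, Pi.mul_apply, Pi.one_apply]
  generalize h x = a; generalize k x = b; revert a b; decide

lemma wt_one : wt A 1 = A.card := by
  simp only [wt, Pi.one_apply, ZMod.val_one, Finset.sum_const, smul_eq_mul, mul_one]

lemma wt_compl (h : BF n) : wt A h + wt A (h + 1) = A.card := by
  simpa [wt_one] using wt_mul_split (A := A) 1 h

lemma wt_mul_three (h b c : BF n) :
    wt A (h * b) + wt A (h * c) + wt A (h * (b + c)) + 2 * wt A (h * ((b + 1) * (c + 1)))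
      = 2 * wt A h := by
  simp only [wt, Finset.mul_sum, ← Finset.sum_add_distrib]
  refine Finset.sum_congr rfl fun x _ => ?_
  simp only [Pi.add_apply, Pi.mul_apply, Pi.one_apply]
  generalize h x = a; generalize b x = b; generalize c x = c; revert a b c; decide

lemma wt_eq_card (h : BF n) : wt A h = (A.filter fun x => h x = 1).card := by
  rw [wt, Finset.card_filter]
  refine Finset.sum_congr rfl fun x _ => ?_
  generalize h x = a; revert a; decide

lemma wt_pos {h : BF n} {x : Fin n → ZMod 2} (hx : x ∈ A) (h1 : h x = 1) : 0 < wt A h := by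
  rw [wt_eq_card, Finset.card_pos]
  exact ⟨x, by simp [hx, h1]⟩

lemma one_lt_wt {h : BF n} {x y : Fin n → ZMod 2} (hx : x ∈ A) (hy : y ∈ A) (hxy : x ≠ y)
    (h1 : h x = 1) (h2 : h y = 1) : 1 < wt A h := by
  rw [wt_eq_card, Finset.one_lt_card]
  exact ⟨x, by simp [hx, h1], y, by simp [hy, h2], hxy⟩

end Weight

section Orthogonal

variable {n : ℕ} {A : Finset (Fin n → ZMod 2)}

lemma QOrth.sum_mul_eq_zero (hA : QOrth A) {h k : BF n} (hh : IsAff h) (hk : IsAff k) :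
    ∑ x ∈ A, h x * k x = 0 := by
  obtain ⟨l, c, rfl⟩ := hh
  obtain ⟨l', c', rfl⟩ := hk
  rw [← hA (fun i j => l i * l' j, fun i => l i * c' + c * l' i, c * c')]
  refine Finset.sum_congr rfl fun x _ => ?_
  have e1 : ∑ i, ∑ j, l i * l' j * (x i * x j) = (∑ i, l i * x i) * ∑ j, l' j * x j := by
    rw [Finset.sum_mul_sum]
    exact Finset.sum_congr rfl fun i _ => Finset.sum_congr rfl fun j _ => by ring
  have e2 : ∑ i, (l i * c' + c * l' i) * x i
      = (∑ i, l i * x i) * c' + c * ∑ j, l' j * x j := by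
    rw [Finset.sum_mul, Finset.mul_sum, ← Finset.sum_add_distrib]
    exact Finset.sum_congr rfl fun i _ => by ring
  simp only [affFun, quadFun, e1, e2]
  ring

lemma QOrth.even_wt_mul (hA : QOrth A) {h k : BF n} (hh : IsAff h) (hk : IsAff k) :
    Even (wt A (h * k)) := by
  rw [← ZMod.natCast_eq_zero_iff_even, ← hA.sum_mul_eq_zero hh hk, wt, Nat.cast_sum]
  exact Finset.sum_congr rfl fun x _ => by simp

lemma QOrth.even_wt (hA : QOrth A) {h : BF n} (hh : IsAff h) : Even (wt A h) := by
  simpa using hA.even_wt_mul hh isAff_one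

lemma QOrth.four_le_wt (hA : QOrth A) {h : BF n} (hh : IsAff h) (h0 : wt A h ≠ 0) :
    4 ≤ wt A h := by
  have he := hA.even_wt hh
  have h2 : 1 < wt A h := by
    obtain ⟨m, hm⟩ := he
    omega
  rw [wt_eq_card, Finset.one_lt_card] at h2
  obtain ⟨x, hx, y, hy, hxy⟩ := h2
  simp only [Finset.mem_filter] at hx hy
  obtain ⟨k, hk, hkx, hky⟩ := exists_isAff_separating hxy
  have h3 := wt_pos (h := h * k) hx.1 (by simp [hx.2, hkx])
  have h4 := wt_pos (h := h * (k + 1)) hy.1 (by simp [hy.2, hky])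
  have h5 := wt_mul_split (A := A) h k
  obtain ⟨a, ha⟩ := hA.even_wt_mul hh hk
  obtain ⟨b, hb⟩ := hA.even_wt_mul hh (hk.add isAff_one)
  omega

lemma QOrth.eight_le_card (hA : QOrth A) (hne : A.Nonempty) : 8 ≤ A.card := by
  have h4 : 4 ≤ A.card := by
    rw [← wt_one]
    exact hA.four_le_wt isAff_one (by rw [wt_one]; exact hne.card_pos.ne')
  obtain ⟨x, hx, y, hy, hxy⟩ := Finset.one_lt_card.mp (show 1 < A.card by omega)
  obtain ⟨k, hk, hkx, hky⟩ := exists_isAff_separating hxy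
  have h1 := hA.four_le_wt hk (wt_pos hx hkx).ne'
  have h2 := hA.four_le_wt (hk.add isAff_one) (wt_pos hy (by simp [hky])).ne'
  have h3 := wt_compl (A := A) k
  omega

/-- An orthogonal set of size eight is closed under sums of three distinct points. -/
lemma QOrth.add_add_mem (hA : QOrth A) (h8 : A.card = 8) {x y z : Fin n → ZMod 2}
    (hx : x ∈ A) (hy : y ∈ A) (hz : z ∈ A) (hxy : x ≠ y) (hxz : x ≠ z) (hyz : y ≠ z) :
    x + y + z ∈ A := by
  classical
  obtain ⟨a, ha, hna⟩ : ∃ a ∈ A, a ∉ ({x, y, z, x + y + z} : Finset (Fin n → ZMod 2)) := by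
    refine Finset.exists_mem_notMem_of_card_lt_card ?_
    have := Finset.card_le_four (a := x) (b := y) (c := z) (d := x + y + z)
    omega
  simp only [Finset.mem_insert, Finset.mem_singleton, not_or] at hna
  obtain ⟨h, hh, h1, h2, h3, h4⟩ :=
    exists_isAff_separating_plane hna.1 hna.2.1 hna.2.2.1 hna.2.2.2
  have e1 := hA.four_le_wt hh (wt_pos hx h1).ne'
  have e2 := hA.four_le_wt (hh.add isAff_one) (wt_pos ha (by simp [h4])).ne'
  have e3 := wt_compl (A := A) h
  have e4 : (A.filter fun x => h x = 1).card = 4 := by rw [← wt_eq_card]; omega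
  obtain ⟨w, hw, hnw⟩ : ∃ w ∈ A.filter (fun x => h x = 1), w ∉ ({x, y, z} : Finset _) := by
    refine Finset.exists_mem_notMem_of_card_lt_card ?_
    have := Finset.card_le_three (a := x) (b := y) (c := z)
    omega
  simp only [Finset.mem_insert, Finset.mem_singleton, not_or] at hnw
  have hset : ({w, x, y, z} : Finset _) = A.filter fun x => h x = 1 := by
    refine Finset.eq_of_subset_of_card_le ?_ ?_
    · intro v hv
      simp only [Finset.mem_insert, Finset.mem_singleton] at hv
      rcases hv with rfl | rfl | rfl | rfl
      · exact hw
      all_goals simp [*]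
    · rw [e4, Finset.card_insert_of_notMem (by simp [hnw]),
        Finset.card_insert_of_notMem (by simp [hxy, hxz]),
        Finset.card_insert_of_notMem (by simp [hyz]), Finset.card_singleton]
  have hweq : x + y + z = w := by
    funext i
    have hs := hA.sum_mul_eq_zero hh (isAff_coord i)
    have : ∑ v ∈ A, h v * v i = ∑ v ∈ A.filter (fun x => h x = 1), v i := by
      rw [Finset.sum_filter]
      refine Finset.sum_congr rfl fun v _ => ?_
      rcases zmod2_cases (h v) with e | e <;> simp [e]
    rw [this, ← hset, Finset.sum_insert (by simp [hnw]),
      Finset.sum_insert (by simp [hxy, hxz]), Finset.sum_insert (by simp [hyz]),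
      Finset.sum_singleton] at hs
    simp only [Pi.add_apply]
    revert hs
    generalize x i = a; generalize y i = b; generalize z i = c; generalize w i = d
    revert a b c d; decide
  rw [hweq]
  exact (Finset.mem_filter.mp hw).1

lemma QOrth.card_ne_ten (hA : QOrth A) : A.card ≠ 10 := by
  intro h10
  have hvals : ∀ h : BF n, IsAff h → wt A h = 0 ∨ wt A h = 4 ∨ wt A h = 6 ∨ wt A h = 10 := by
    intro h hh
    obtain ⟨a, ha⟩ := hA.even_wt hh
    have e1 := hA.four_le_wt hh
    have e2 := hA.four_le_wt (hh.add isAff_one)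
    have e3 := wt_compl (A := A) h
    omega
  have hsep : ∀ x ∈ A, ∀ y ∈ A, x ≠ y → ∃ h : BF n, IsAff h ∧ wt A h = 4 ∧
      (h x = 1 ∧ h y = 0 ∨ h x = 0 ∧ h y = 1) := by
    intro x hx y hy hxy
    obtain ⟨k, hk, hkx, hky⟩ := exists_isAff_separating hxy
    have e1 := wt_pos hx hkx
    have e2 := wt_pos (h := k + 1) hy (by simp [hky])
    have e3 := wt_compl (A := A) k
    rcases hvals k hk with e | e | e | e
    · omega
    · exact ⟨k, hk, e, Or.inl ⟨hkx, hky⟩⟩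
    · exact ⟨k + 1, hk.add isAff_one, by omega,
        Or.inr ⟨by simp [hkx]; decide, by simp [hky]⟩⟩
    · omega
  have hinter : ∀ h k : BF n, IsAff h → IsAff k → wt A h = 4 → wt A k = 4 →
      wt A (h * k) = 2 ∧ wt A (h + k) = 4 ∨ wt A (h * k) = 4 ∧ wt A (h + k) = 0 := by
    intro h k hh hk e1 e2
    have e3 := wt_add (A := A) h k
    have e4 := hvals _ (hh.add hk)
    obtain ⟨a, ha⟩ := hA.even_wt_mul hh hk
    omega
  obtain ⟨x0, hx0, y0, hy0, hxy0⟩ := Finset.one_lt_card.mp (show 1 < A.card by omega)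
  obtain ⟨b, hb, hb4, -⟩ := hsep x0 hx0 y0 hy0 hxy0
  have hb6 : wt A (b + 1) = 6 := by
    have := wt_compl (A := A) b
    omega
  obtain ⟨u, hu, v, hv, huv⟩ := Finset.one_lt_card.mp
    (show 1 < (A.filter fun x => (b + 1 : BF n) x = 1).card by rw [← wt_eq_card]; omega)
  simp only [Finset.mem_filter, Pi.add_apply, Pi.one_apply, add_eq_right] at hu hv
  obtain ⟨c, hc, hc4, hcuv⟩ := hsep u hu.1 v hv.1 huv
  have hbc : wt A (b + c) = 4 ∧ wt A (b * c) = 2 := by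
    have : 0 < wt A (b + c) := by
      rcases hcuv with e | e
      · exact wt_pos hu.1 (by simp [hu.2, e.1])
      · exact wt_pos hv.1 (by simp [hv.2, e.2])
    have := hinter b c hb hc hb4 hc4
    omega
  set r : BF n := (b + 1) * (c + 1) with hr
  have hr4 : wt A r = 4 := by
    have := wt_mul_three (A := A) 1 b c
    simp only [one_mul, wt_one] at this
    rw [hr]
    omega
  have hle : ∀ h : BF n, IsAff h → wt A h = 4 → wt A (h * r) ≤ 1 := by
    intro h hh h4
    have e1 := hinter h b hh hb h4 hb4
    have e2 := hinter h c hh hc h4 hc4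
    have e3 := hinter h _ hh (hb.add hc) h4 hbc.1
    have e4 := wt_mul_three (A := A) h b c
    rw [← hr] at e4
    omega
  rw [wt_eq_card, Finset.card_eq_succ] at hr4
  obtain ⟨r1, t, hr1, hrt, ht⟩ := hr4
  rw [Finset.card_eq_three] at ht
  obtain ⟨r2, r3, r4, h23, h24, h34, rfl⟩ := ht
  simp only [Finset.mem_insert, Finset.mem_singleton, not_or] at hr1
  have hmem : ∀ w ∈ insert r1 ({r2, r3, r4} : Finset (Fin n → ZMod 2)), w ∈ A ∧ r w = 1 := by
    intro w hw
    rw [hrt] at hw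
    simpa using hw
  have m1 := hmem r1 (by simp)
  have m2 := hmem r2 (by simp)
  have m3 := hmem r3 (by simp)
  have m4 := hmem r4 (by simp)
  have hzero : ∀ h : BF n, IsAff h → wt A h = 4 → ∀ p q, p ∈ A → q ∈ A → r p = 1 → r q = 1 →
      p ≠ q → h p = 1 → h q = 0 := by
    intro h hh h4 p q hp hq hrp hrq hpq h1
    rcases zmod2_cases (h q) with e | e
    · exact e
    · have := one_lt_wt (h := h * r) hp hq hpq (by simp [h1, hrp]) (by simp [e, hrq])
      have := hle h hh h4
      omega
  have hpick : ∀ p q, p ∈ A → q ∈ A → r p = 1 → r q = 1 → p ≠ q →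
      ∃ h : BF n, IsAff h ∧ wt A h = 4 ∧ ∃ s, (s = p ∨ s = q) ∧ h s = 1 := by
    intro p q hp hq _ _ hpq
    obtain ⟨h, hh, h4, e | e⟩ := hsep p hp q hq hpq
    · exact ⟨h, hh, h4, p, Or.inl rfl, e.1⟩
    · exact ⟨h, hh, h4, q, Or.inr rfl, e.2⟩
  obtain ⟨h, hh, h4, s, hs, hs1⟩ := hpick r1 r2 m1.1 m2.1 m1.2 m2.2 hr1.1
  obtain ⟨k, hk, k4, s', hs', hs1'⟩ := hpick r3 r4 m3.1 m4.1 m3.2 m4.2 h34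
  have ms : s ∈ A ∧ r s = 1 := by rcases hs with rfl | rfl <;> assumption
  have ms' : s' ∈ A ∧ r s' = 1 := by rcases hs' with rfl | rfl <;> assumption
  have hss : s ≠ s' := by
    rcases hs with rfl | rfl <;> rcases hs' with rfl | rfl
    exacts [hr1.2.1, hr1.2.2, h23, h24]
  have z1 := hzero h hh h4 s s' ms.1 ms'.1 ms.2 ms'.2 hss hs1
  have z2 := hzero k hk k4 s' s ms'.1 ms.1 ms'.2 ms.2 hss.symm hs1'
  have hsum4 : wt A (h + k) = 4 := by
    have := wt_pos (h := h + k) ms.1 (by simp [hs1, z2])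
    have := hinter h k hh hk h4 k4
    omega
  have e := hzero _ (hh.add hk) hsum4 s s' ms.1 ms'.1 ms.2 ms'.2 hss (by simp [hs1, z2])
  simp [z1, hs1'] at e

end Orthogonal

/-- The sign `(-1)^a`. -/
def sgn (a : ZMod 2) : ℤ := if a = 0 then 1 else -1

lemma sgn_add (a b : ZMod 2) : sgn (a + b) = sgn a * sgn b := by
  revert a b; decide

lemma sgn_sum {ι : Type*} (A : Finset ι) (g : ι → ZMod 2) :
    sgn (∑ x ∈ A, g x) = ∏ x ∈ A, sgn (g x) := by
  classical
  induction A using Finset.induction_on with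
  | empty => simp [sgn]
  | insert a A ha ih => rw [Finset.sum_insert ha, Finset.prod_insert ha, sgn_add, ih]

lemma sgn_mul_self (a : ZMod 2) : sgn a * sgn a = 1 := by
  revert a; decide

section Average

variable {n : ℕ}

lemma quadFun_add (p q : QuadCoeff n) (x : Fin n → ZMod 2) :
    quadFun (p + q) x = quadFun p x + quadFun q x := by
  simp only [quadFun, Prod.fst_add, Prod.snd_add, Pi.add_apply, add_mul, Finset.sum_add_distrib]
  ring

lemma sum_prod_sgn_quadFun (A : Finset (Fin n → ZMod 2)) [Decidable (QOrth A)] :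
    ∑ p : QuadCoeff n, ∏ x ∈ A, sgn (quadFun p x)
      = if QOrth A then (Fintype.card (QuadCoeff n) : ℤ) else 0 := by
  simp only [← sgn_sum]
  split_ifs with hA
  · simp [hA _, sgn]
  · unfold QOrth at hA
    push Not at hA
    obtain ⟨p₀, hp₀⟩ := hA
    have h1 : ∑ x ∈ A, quadFun p₀ x = 1 := (zmod2_cases _).resolve_left hp₀
    have h2 := Equiv.sum_comp (Equiv.addRight p₀)
      (fun p : QuadCoeff n => sgn (∑ x ∈ A, quadFun p x))
    have h3 : sgn 1 = -1 := by decide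
    simp only [Equiv.coe_addRight, quadFun_add, Finset.sum_add_distrib, h1, sgn_add, h3,
      mul_neg, mul_one, Finset.sum_neg_distrib] at h2
    omega

end Average

section ElementarySymmetric

variable {ι : Type*} [Fintype ι]

/-- The elementary symmetric sum of degree `k` of a finite family. -/
def elemSymm (s : ι → ℤ) (k : ℕ) : ℤ :=
  ∑ A ∈ (Finset.univ : Finset ι).powersetCard k, ∏ x ∈ A, s x

open Polynomial in
lemma coeff_prod_one_add (s : ι → ℤ) (k : ℕ) :
    (∏ x, (1 + C (s x) * X)).coeff k = elemSymm s k := by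
  classical
  simp only [Finset.prod_one_add, Finset.prod_mul_distrib, Finset.prod_const, ← map_prod,
    finsetSum_coeff, coeff_C_mul, coeff_X_pow, elemSymm]
  simp only [mul_ite, mul_one, mul_zero, ← Finset.sum_filter]
  refine Finset.sum_congr ?_ fun _ _ => rfl
  ext A
  simp [Finset.mem_powersetCard, eq_comm]

open Polynomial in
lemma sum_mul_elemSymm {s : ι → ℤ} (hs : ∀ x, s x * s x = 1) (k : ℕ) :
    (∑ x, s x) * elemSymm s (k + 1)
      = (k + 2) * elemSymm s (k + 2) + (Fintype.card ι - k) * elemSymm s k := by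
  classical
  set P : ℤ[X] := ∏ x, (1 + C (s x) * X) with hP
  have hd : (1 - X ^ 2) * derivative P = (C (∑ x, s x) - C (Fintype.card ι : ℤ) * X) * P := by
    have hC : C (∑ x, s x) - C (Fintype.card ι : ℤ) * X = ∑ x, (C (s x) - X) := by
      simp [Finset.sum_sub_distrib, map_sum]
    rw [hC, hP, derivative_prod_finset, Finset.mul_sum, Finset.sum_mul]
    refine Finset.sum_congr rfl fun x hx => ?_
    have h1 : C (s x) * C (s x) = 1 := by rw [← C_mul, hs, C_1]
    rw [← Finset.mul_prod_erase _ _ hx]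
    simp only [derivative_add, derivative_one, derivative_C_mul, derivative_X, zero_add, mul_one]
    linear_combination (-X * ∏ y ∈ Finset.univ.erase x, (1 + C (s y) * X)) * h1
  have hX : (X * derivative P).coeff k = k * P.coeff k := by
    cases k with
    | zero => simp
    | succ m => rw [coeff_X_mul, coeff_derivative]; push_cast; ring
  have hc := congrArg (fun Q : ℤ[X] => Q.coeff (k + 1)) hd
  simp only [sub_mul, one_mul, coeff_sub, mul_assoc, coeff_C_mul, pow_two, coeff_X_mul, hX,
    coeff_derivative] at hc
  simp only [hP, coeff_prod_one_add] at hc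
  push_cast at hc
  linear_combination -hc

end ElementarySymmetric

section Cubes

variable {n : ℕ}

/-- The three-dimensional parallelepiped spanned by four points. -/
def cube (t : (Fin n → ZMod 2) × (Fin n → ZMod 2) × (Fin n → ZMod 2) × (Fin n → ZMod 2)) :
    Finset (Fin n → ZMod 2) :=
  {t.1, t.2.1, t.2.2.1, t.1 + t.2.1 + t.2.2.1, t.2.2.2, t.1 + t.2.1 + t.2.2.2,
    t.1 + t.2.2.1 + t.2.2.2, t.2.1 + t.2.2.1 + t.2.2.2}

/-- Four points in general position. -/
def GenPos (t : (Fin n → ZMod 2) × (Fin n → ZMod 2) × (Fin n → ZMod 2) × (Fin n → ZMod 2)) :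
    Prop :=
  (t.1 ≠ t.2.1 ∧ t.1 ≠ t.2.2.1 ∧ t.2.1 ≠ t.2.2.1) ∧
    t.2.2.2 ∉ ({t.1, t.2.1, t.2.2.1, t.1 + t.2.1 + t.2.2.1} : Finset (Fin n → ZMod 2))

instance : DecidablePred (GenPos (n := n)) := fun _ => by unfold GenPos; infer_instance

lemma two_eq_zero_fun : (2 : Fin n → ZMod 2) = 0 := by
  funext i; simp; decide

lemma card_plane {x y z : Fin n → ZMod 2} (hxy : x ≠ y) (hxz : x ≠ z) (hyz : y ≠ z) :
    ({x, y, z, x + y + z} : Finset (Fin n → ZMod 2)).card = 4 := by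
  have h2 := two_eq_zero_fun (n := n)
  rw [Finset.card_insert_of_notMem, Finset.card_insert_of_notMem, Finset.card_insert_of_notMem,
    Finset.card_singleton]
  · simp only [Finset.mem_singleton]
    grind
  · simp only [Finset.mem_insert, Finset.mem_singleton, not_or]
    refine ⟨?_, ?_⟩ <;> grind
  · simp only [Finset.mem_insert, Finset.mem_singleton, not_or]
    refine ⟨?_, ?_, ?_⟩ <;> grind

lemma sum_prod_cube {M : Type*} [CommMonoid M] (g : (Fin n → ZMod 2) → M)
    {t : (Fin n → ZMod 2) × (Fin n → ZMod 2) × (Fin n → ZMod 2) × (Fin n → ZMod 2)}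
    (ht : GenPos t) :
    (cube t).card = 8 ∧ ∏ v ∈ cube t, g v =
      g t.1 * (g t.2.1 * (g t.2.2.1 * (g (t.1 + t.2.1 + t.2.2.1) * (g t.2.2.2 *
        (g (t.1 + t.2.1 + t.2.2.2) * (g (t.1 + t.2.2.1 + t.2.2.2) *
          g (t.2.1 + t.2.2.1 + t.2.2.2))))))) := by
  have h2 := two_eq_zero_fun (n := n)
  obtain ⟨x, y, z, w⟩ := t
  simp only [GenPos, Finset.mem_insert, Finset.mem_singleton, not_or] at ht
  obtain ⟨⟨h1, h3, h4⟩, h5, h6, h7, h8⟩ := ht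
  have n1 : x ∉ ({y, z, x + y + z, w, x + y + w, x + z + w, y + z + w} : Finset _) := by
    simp only [Finset.mem_insert, Finset.mem_singleton, not_or]
    refine ⟨?_, ?_, ?_, ?_, ?_, ?_, ?_⟩ <;> grind
  have n2 : y ∉ ({z, x + y + z, w, x + y + w, x + z + w, y + z + w} : Finset _) := by
    simp only [Finset.mem_insert, Finset.mem_singleton, not_or]
    refine ⟨?_, ?_, ?_, ?_, ?_, ?_⟩ <;> grind
  have n3 : z ∉ ({x + y + z, w, x + y + w, x + z + w, y + z + w} : Finset _) := by
    simp only [Finset.mem_insert, Finset.mem_singleton, not_or]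
    refine ⟨?_, ?_, ?_, ?_, ?_⟩ <;> grind
  have n4 : x + y + z ∉ ({w, x + y + w, x + z + w, y + z + w} : Finset _) := by
    simp only [Finset.mem_insert, Finset.mem_singleton, not_or]
    refine ⟨?_, ?_, ?_, ?_⟩ <;> grind
  have n5 : w ∉ ({x + y + w, x + z + w, y + z + w} : Finset _) := by
    simp only [Finset.mem_insert, Finset.mem_singleton, not_or]
    refine ⟨?_, ?_, ?_⟩ <;> grind
  have n6 : x + y + w ∉ ({x + z + w, y + z + w} : Finset _) := by
    simp only [Finset.mem_insert, Finset.mem_singleton, not_or]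
    refine ⟨?_, ?_⟩ <;> grind
  have n7 : x + z + w ∉ ({y + z + w} : Finset _) := by
    simp only [Finset.mem_singleton]
    grind
  constructor
  · simp only [cube]
    rw [Finset.card_insert_of_notMem n1, Finset.card_insert_of_notMem n2,
      Finset.card_insert_of_notMem n3, Finset.card_insert_of_notMem n4,
      Finset.card_insert_of_notMem n5, Finset.card_insert_of_notMem n6,
      Finset.card_insert_of_notMem n7, Finset.card_singleton]
  · simp only [cube]
    rw [Finset.prod_insert n1, Finset.prod_insert n2, Finset.prod_insert n3,
      Finset.prod_insert n4, Finset.prod_insert n5, Finset.prod_insert n6,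
      Finset.prod_insert n7, Finset.prod_singleton]

lemma linear_cube_sum_eq_zero {R : Type*} [CommRing R] (h2 : (2 : R) = 0) (b x y z w : R) :
    b * x + (b * y + (b * z + (b * (x + y + z) + (b * w + (b * (x + y + w)
      + (b * (x + z + w) + b * (y + z + w))))))) = 0 := by
  grind

lemma mul_cube_sum_eq_zero {R : Type*} [CommRing R] (h2 : (2 : R) = 0)
    (a x y z w x' y' z' w' : R) :
    a * (x * x') + (a * (y * y') + (a * (z * z') + (a * ((x + y + z) * (x' + y' + z'))
      + (a * (w * w') + (a * ((x + y + w) * (x' + y' + w'))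
      + (a * ((x + z + w) * (x' + z' + w')) + a * ((y + z + w) * (y' + z' + w')))))))) = 0 := by
  grind

lemma qOrth_cube
    {t : (Fin n → ZMod 2) × (Fin n → ZMod 2) × (Fin n → ZMod 2) × (Fin n → ZMod 2)}
    (ht : GenPos t) : QOrth (cube t) := by
  intro p
  have h := (sum_prod_cube (M := Multiplicative (ZMod 2))
    (fun v => Multiplicative.ofAdd (quadFun p v)) ht).2
  obtain ⟨x, y, z, w⟩ := t
  have h' : ∑ v ∈ cube (x, y, z, w), quadFun p v = quadFun p x + (quadFun p y + (quadFun p z +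
      (quadFun p (x + y + z) + (quadFun p w + (quadFun p (x + y + w) + (quadFun p (x + z + w) +
        quadFun p (y + z + w))))))) := h
  rw [h']
  have h2 : (2 : ZMod 2) = 0 := by decide
  obtain ⟨a, b, c⟩ := p
  have e1 : ∑ i, ∑ j, a i j * (x i * x j) + (∑ i, ∑ j, a i j * (y i * y j)
      + (∑ i, ∑ j, a i j * (z i * z j)
      + (∑ i, ∑ j, a i j * ((x + y + z) i * (x + y + z) j) + (∑ i, ∑ j, a i j * (w i * w j)
      + (∑ i, ∑ j, a i j * ((x + y + w) i * (x + y + w) j)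
      + (∑ i, ∑ j, a i j * ((x + z + w) i * (x + z + w) j)
      + ∑ i, ∑ j, a i j * ((y + z + w) i * (y + z + w) j))))))) = 0 := by
    simp only [← Finset.sum_add_distrib]
    refine Finset.sum_eq_zero fun i _ => Finset.sum_eq_zero fun j _ => ?_
    exact mul_cube_sum_eq_zero h2 _ _ _ _ _ _ _ _ _
  have e2 : ∑ i, b i * x i + (∑ i, b i * y i + (∑ i, b i * z i + (∑ i, b i * (x + y + z) i
      + (∑ i, b i * w i + (∑ i, b i * (x + y + w) i + (∑ i, b i * (x + z + w) i
      + ∑ i, b i * (y + z + w) i)))))) = 0 := by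
    simp only [← Finset.sum_add_distrib]
    refine Finset.sum_eq_zero fun i _ => ?_
    exact linear_cube_sum_eq_zero h2 _ _ _ _ _
  simp only [quadFun]
  linear_combination e1 + e2 + 4 * c * h2

lemma QOrth.cube_eq {A : Finset (Fin n → ZMod 2)} (hA : QOrth A) (h8 : A.card = 8)
    {t : (Fin n → ZMod 2) × (Fin n → ZMod 2) × (Fin n → ZMod 2) × (Fin n → ZMod 2)}
    (ht : GenPos t) (hx : t.1 ∈ A) (hy : t.2.1 ∈ A) (hz : t.2.2.1 ∈ A) (hw : t.2.2.2 ∈ A) :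
    cube t = A := by
  have hc := (sum_prod_cube (M := Multiplicative (ZMod 2)) (fun _ => 1) ht).1
  refine Finset.eq_of_subset_of_card_le ?_ (by omega)
  obtain ⟨x, y, z, w⟩ := t
  simp only [GenPos, Finset.mem_insert, Finset.mem_singleton, not_or] at ht
  obtain ⟨⟨h1, h3, h4⟩, h5, h6, h7, h8'⟩ := ht
  intro v hv
  simp only [cube, Finset.mem_insert, Finset.mem_singleton] at hv
  rcases hv with rfl | rfl | rfl | rfl | rfl | rfl | rfl | rfl
  · exact hx
  · exact hy
  · exact hz
  · exact hA.add_add_mem h8 hx hy hz h1 h3 h4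
  · exact hw
  · exact hA.add_add_mem h8 hx hy hw h1 (Ne.symm h5) (Ne.symm h6)
  · exact hA.add_add_mem h8 hx hz hw h3 (Ne.symm h5) (Ne.symm h7)
  · exact hA.add_add_mem h8 hy hz hw h4 (Ne.symm h6) (Ne.symm h7)

lemma QOrth.card_genPos {A : Finset (Fin n → ZMod 2)} (hA : QOrth A) (h8 : A.card = 8) :
    ∑ t : (Fin n → ZMod 2) × (Fin n → ZMod 2) × (Fin n → ZMod 2) × (Fin n → ZMod 2),
      (if GenPos t ∧ t.1 ∈ A ∧ t.2.1 ∈ A ∧ t.2.2.1 ∈ A ∧ t.2.2.2 ∈ A then (1 : ℤ) else 0)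
        = 1344 := by
  have hw : ∀ x y z, ∑ w, (if GenPos (x, y, z, w) ∧ x ∈ A ∧ y ∈ A ∧ z ∈ A ∧ w ∈ A
      then (1 : ℤ) else 0) = if z ∈ (A.erase x).erase y then
        (if x ∈ A ∧ y ∈ A.erase x then 4 else 0) else 0 := by
    intro x y z
    by_cases h : (x ≠ y ∧ x ≠ z ∧ y ≠ z) ∧ x ∈ A ∧ y ∈ A ∧ z ∈ A
    · obtain ⟨⟨h1, h3, h4⟩, hx, hy, hz⟩ := h
      rw [if_pos (by simp [hz, h3.symm, h4.symm]), if_pos (by simp [hx, hy, h1.symm]),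
        ← Finset.sum_filter, Finset.sum_const]
      have hf : (Finset.univ.filter fun w => GenPos (x, y, z, w) ∧ x ∈ A ∧ y ∈ A ∧ z ∈ A ∧ w ∈ A)
          = A \ {x, y, z, x + y + z} := by
        ext w
        rw [Finset.mem_filter, Finset.mem_sdiff]
        simp only [GenPos, Finset.mem_univ, true_and]
        tauto
      rw [hf, Finset.card_sdiff_of_subset, h8, card_plane h1 h3 h4]
      · norm_num
      · intro v hv
        simp only [Finset.mem_insert, Finset.mem_singleton] at hv
        rcases hv with rfl | rfl | rfl | rfl
        exacts [hx, hy, hz, hA.add_add_mem h8 hx hy hz h1 h3 h4]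
    · rw [Finset.sum_eq_zero]
      · split_ifs with h1 h2
        · simp only [Finset.mem_erase] at h1 h2
          exact absurd ⟨⟨Ne.symm h2.2.1, Ne.symm h1.2.1, Ne.symm h1.1⟩, h2.1, h2.2.2, h1.2.2⟩ h
        · rfl
        · rfl
      · intro w _
        rw [if_neg]
        rintro ⟨⟨h1, -⟩, h2, h3, h4, -⟩
        exact h ⟨h1, h2, h3, h4⟩
  have hz : ∀ x y, ∑ z, (if z ∈ (A.erase x).erase y then
      (if x ∈ A ∧ y ∈ A.erase x then (4 : ℤ) else 0) else 0)
        = if y ∈ A.erase x then (if x ∈ A then 24 else 0) else 0 := by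
    intro x y
    rw [← Finset.sum_filter, Finset.filter_univ_mem, Finset.sum_const]
    by_cases hy : y ∈ A.erase x <;> by_cases hx : x ∈ A
    · rw [Finset.card_erase_of_mem hy, Finset.card_erase_of_mem hx, h8]
      simp [hx, Finset.mem_erase.mp hy]
    all_goals simp [hx, hy]
  have hy : ∀ x, ∑ y, (if y ∈ A.erase x then (if x ∈ A then (24 : ℤ) else 0) else 0)
        = if x ∈ A then 168 else 0 := by
    intro x
    rw [← Finset.sum_filter, Finset.filter_univ_mem, Finset.sum_const]
    by_cases hx : x ∈ A
    · rw [Finset.card_erase_of_mem hx, h8]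
      simp [hx]
    · simp [hx]
  simp only [Fintype.sum_prod_type, hw, hz, hy]
  rw [← Finset.sum_filter, Finset.filter_univ_mem, Finset.sum_const, h8]
  norm_num

open Classical in
lemma cube_sum_eq (g : (Fin n → ZMod 2) → ℤ) :
    1344 * ∑ A ∈ (Finset.univ.powersetCard 8).filter QOrth, ∏ x ∈ A, g x
      = ∑ t : (Fin n → ZMod 2) × (Fin n → ZMod 2) × (Fin n → ZMod 2) × (Fin n → ZMod 2),
        if GenPos t then ∏ x ∈ cube t, g x else 0 := by
  have h1 : ∀ t : (Fin n → ZMod 2) × (Fin n → ZMod 2) × (Fin n → ZMod 2) × (Fin n → ZMod 2),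
      (if GenPos t then ∏ x ∈ cube t, g x else 0)
        = ∑ A ∈ (Finset.univ.powersetCard 8).filter QOrth,
          (∏ x ∈ A, g x) *
            (if GenPos t ∧ t.1 ∈ A ∧ t.2.1 ∈ A ∧ t.2.2.1 ∈ A ∧ t.2.2.2 ∈ A then
              (1 : ℤ) else 0) := by
    intro t
    by_cases ht : GenPos t
    · rw [Finset.sum_eq_single (cube t)]
      · simp [ht, cube]
      · intro A hA hne
        simp only [Finset.mem_filter, Finset.mem_powersetCard] at hA
        rw [if_neg, mul_zero]
        rintro ⟨-, hx, hy, hz, hw⟩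
        exact hne (hA.2.cube_eq hA.1.2 ht hx hy hz hw).symm
      · intro h
        refine absurd ?_ h
        simp only [Finset.mem_filter, Finset.mem_powersetCard]
        exact ⟨⟨Finset.subset_univ _, (sum_prod_cube g ht).1⟩, qOrth_cube ht⟩
    · simp [ht]
  simp only [h1]
  rw [Finset.sum_comm, Finset.mul_sum]
  refine Finset.sum_congr rfl fun A hA => ?_
  simp only [Finset.mem_filter, Finset.mem_powersetCard] at hA
  rw [← Finset.mul_sum, hA.2.card_genPos hA.1.2, mul_comm]

/-- The product of `g` over the plane through `x` with directions `a` and `b`. -/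
def planeProd (g : (Fin n → ZMod 2) → ℤ) (a b x : Fin n → ZMod 2) : ℤ :=
  g x * g (x + a) * g (x + b) * g (x + a + b)

lemma planeProd_le_one {g : (Fin n → ZMod 2) → ℤ} (hg : ∀ x, g x * g x = 1)
    (a b x y : Fin n → ZMod 2) : planeProd g a b x * planeProd g a b y ≤ 1 := by
  have h : ∀ z, planeProd g a b z * planeProd g a b z = 1 := by
    intro z
    simp only [planeProd]
    calc _ = (g z * g z) * (g (z + a) * g (z + a)) * (g (z + b) * g (z + b))
        * (g (z + a + b) * g (z + a + b)) := by ring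
      _ = 1 := by simp [hg]
  nlinarith [sq_nonneg (planeProd g a b x - planeProd g a b y), h x, h y]

open Classical in
lemma cube_sum_lower_bound {g : (Fin n → ZMod 2) → ℤ} (hg : ∀ x, g x * g x = 1) :
    -(4 * (2 ^ n) ^ 3)
      ≤ 1344 * ∑ A ∈ (Finset.univ.powersetCard 8).filter QOrth, ∏ x ∈ A, g x := by
  have h2 := two_eq_zero_fun (n := n)
  rw [cube_sum_eq]
  simp only [Fintype.sum_prod_type]
  have key : ∀ x y z : Fin n → ZMod 2,
      (if x ≠ y ∧ x ≠ z ∧ y ≠ z then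
        ∑ w, planeProd g (x + y) (x + z) x * planeProd g (x + y) (x + z) w else 0) - 4
        ≤ ∑ w, if GenPos (x, y, z, w) then ∏ v ∈ cube (x, y, z, w), g v else 0 := by
    intro x y z
    split_ifs with h
    · have hsplit : ∀ w, (if GenPos (x, y, z, w) then ∏ v ∈ cube (x, y, z, w), g v else 0)
          = planeProd g (x + y) (x + z) x * planeProd g (x + y) (x + z) w
            - if w ∈ ({x, y, z, x + y + z} : Finset (Fin n → ZMod 2)) then
              planeProd g (x + y) (x + z) x * planeProd g (x + y) (x + z) w else 0 := by
        intro w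
        by_cases hw : w ∈ ({x, y, z, x + y + z} : Finset (Fin n → ZMod 2))
        · rw [if_pos hw, if_neg (fun hG => hG.2 hw), sub_self]
        · have hG : GenPos (x, y, z, w) := ⟨h, hw⟩
          rw [if_neg hw, if_pos hG, (sum_prod_cube g hG).2, sub_zero]
          simp only [planeProd]
          rw [show x + (x + y) = y by grind, show x + (x + z) = z by grind,
            show y + (x + z) = x + y + z by abel, show w + (x + y) = x + y + w by abel,
            show w + (x + z) = x + z + w by abel, show x + y + w + (x + z) = y + z + w by grind]
          ring
      rw [Finset.sum_congr rfl fun w _ => hsplit w, Finset.sum_sub_distrib, ← Finset.sum_filter,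
        Finset.filter_univ_mem]
      have := Finset.sum_le_card_nsmul ({x, y, z, x + y + z} : Finset (Fin n → ZMod 2))
        (fun w => planeProd g (x + y) (x + z) x * planeProd g (x + y) (x + z) w) 1
        (fun w _ => planeProd_le_one hg _ _ _ _)
      rw [card_plane h.1 h.2.1 h.2.2] at this
      simp only [nsmul_eq_mul, mul_one] at this
      push_cast at this
      linarith
    · rw [Finset.sum_eq_zero]
      · norm_num
      · exact fun w _ => if_neg fun hG => h hG.1
  have hsq : 0 ≤ ∑ x : Fin n → ZMod 2, ∑ y, ∑ z, if x ≠ y ∧ x ≠ z ∧ y ≠ z then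
      ∑ w, planeProd g (x + y) (x + z) x * planeProd g (x + y) (x + z) w else 0 := by
    have hshift : ∀ x : Fin n → ZMod 2, (∑ y, ∑ z, if x ≠ y ∧ x ≠ z ∧ y ≠ z then
        ∑ w, planeProd g (x + y) (x + z) x * planeProd g (x + y) (x + z) w else 0)
        = ∑ a, ∑ b, if a ≠ 0 ∧ b ≠ 0 ∧ a ≠ b then
          ∑ w, planeProd g a b x * planeProd g a b w else 0 := by
      intro x
      refine Fintype.sum_equiv (Equiv.addLeft x) _ _ fun y =>
        Fintype.sum_equiv (Equiv.addLeft x) _ _ fun z => ?_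
      simp only [Equiv.coe_addLeft]
      have c1 : x + y ≠ 0 ↔ x ≠ y := by constructor <;> intro h <;> grind
      have c2 : x + z ≠ 0 ↔ x ≠ z := by constructor <;> intro h <;> grind
      simp only [c1, c2, ne_eq, add_right_inj]
    simp only [hshift]
    rw [Finset.sum_comm]
    refine Finset.sum_nonneg fun a _ => ?_
    rw [Finset.sum_comm]
    refine Finset.sum_nonneg fun b _ => ?_
    by_cases h : a ≠ 0 ∧ b ≠ 0 ∧ a ≠ b
    · simp only [if_pos h, ← Finset.mul_sum, ← Finset.sum_mul]
      exact mul_self_nonneg _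
    · simp [if_neg h]
  have hle := Finset.sum_le_sum fun x (_ : x ∈ Finset.univ) =>
    Finset.sum_le_sum fun y (_ : y ∈ Finset.univ) =>
      Finset.sum_le_sum fun z (_ : z ∈ Finset.univ) => key x y z
  simp only [Finset.sum_sub_distrib] at hle
  simp only [Finset.sum_const, Finset.card_univ, Fintype.card_pi, ZMod.card, Finset.prod_const,
    Fintype.card_fin, nsmul_eq_mul] at hle
  push_cast at hle
  linarith

end Cubes

section Bound

variable {n : ℕ}

lemma quadFun_mem_RM (p : QuadCoeff n) : quadFun p ∈ RM 2 n := by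
  refine ⟨∑ i, ∑ j, MvPolynomial.C (p.1 i j) * (MvPolynomial.X i * MvPolynomial.X j)
    + ∑ i, MvPolynomial.C (p.2.1 i) * MvPolynomial.X i + MvPolynomial.C p.2.2, ?_, ?_⟩
  · refine (MvPolynomial.totalDegree_add _ _).trans (max_le ?_ (by simp))
    refine (MvPolynomial.totalDegree_add _ _).trans (max_le ?_ ?_)
    · refine MvPolynomial.totalDegree_finsetSum_le fun i _ =>
        MvPolynomial.totalDegree_finsetSum_le fun j _ => ?_
      refine (MvPolynomial.totalDegree_mul _ _).trans ?_
      have := MvPolynomial.totalDegree_mul (MvPolynomial.X i : MvPolynomial (Fin n) (ZMod 2))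
        (MvPolynomial.X j)
      simp only [MvPolynomial.totalDegree_X, MvPolynomial.totalDegree_C] at this ⊢
      omega
    · refine MvPolynomial.totalDegree_finsetSum_le fun i _ => ?_
      refine (MvPolynomial.totalDegree_mul _ _).trans ?_
      simp
  · intro x
    simp [quadFun]

lemma sum_sgn_add_eq (f g : BF n) : ∑ x, sgn (f x + g x) = 2 ^ n - 2 * (hd f g : ℤ) := by
  have h : ∀ x, sgn (f x + g x) = 1 - 2 * (if f x ≠ g x then 1 else 0 : ℤ) := by
    intro x
    generalize f x = a
    generalize g x = b
    revert a b
    decide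
  simp only [h, Finset.sum_sub_distrib, ← Finset.mul_sum, hd, Finset.card_filter]
  simp

/-- The average over all `q` of degree at most two of the elementary symmetric sums of
`(-1)^(f+q)` is supported on orthogonal sets. -/
lemma sum_elemSymm_sgn [DecidablePred (QOrth (n := n))] (f : BF n) (k : ℕ) :
    ∑ p : QuadCoeff n, elemSymm (fun x => sgn (f x + quadFun p x)) k
      = Fintype.card (QuadCoeff n) *
        ∑ A ∈ (Finset.univ.powersetCard k).filter QOrth, ∏ x ∈ A, sgn (f x) := by
  simp only [elemSymm, sgn_add, Finset.prod_mul_distrib]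
  rw [Finset.sum_comm, Finset.sum_filter, Finset.mul_sum]
  refine Finset.sum_congr rfl fun A _ => ?_
  rw [← Finset.mul_sum, sum_prod_sgn_quadFun]
  split_ifs <;> ring

lemma sum_elemSymm_sgn_eq_zero (f : BF n) {k : ℕ} (h0 : k ≠ 0) (hk : k < 8 ∨ k = 10) :
    ∑ p : QuadCoeff n, elemSymm (fun x => sgn (f x + quadFun p x)) k = 0 := by
  classical
  rw [sum_elemSymm_sgn, Finset.sum_eq_zero, mul_zero]
  intro A hA
  exfalso
  simp only [Finset.mem_filter, Finset.mem_powersetCard] at hA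
  have h1 := hA.2.card_ne_ten
  have h2 := hA.2.eight_le_card (Finset.card_pos.mp (by omega))
  omega

/-- Expansion of a degree-ten polynomial, nonpositive on `[-102, 102]`, in the elementary
symmetric sums of `1024` signs. -/
lemma polynomial_expansion (S : ℤ) (e : ℕ → ℤ) (h0 : e 0 = 1) (h1 : S = e 1)
    (h : ∀ k : ℕ, S * e (k + 1) = (k + 2) * e (k + 2) + (1024 - k) * e k) :
    (S ^ 4 - 3584 * S ^ 2 + 1048576) ^ 2 * (S ^ 2 - 10404)
      = 32710646822141952 + 1118826028122624 * e 2 + 17065859300352 * e 4 + 174733943040 * e 6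
        + 1139765760 * e 8 + 3628800 * e 10 := by
  have r0 := h 0
  have r1 := h 1
  have r2 := h 2
  have r3 := h 3
  have r4 := h 4
  have r5 := h 5
  have r6 := h 6
  have r7 := h 7
  have r8 := h 8
  norm_num at r0 r1 r2 r3 r4 r5 r6 r7 r8
  rw [h0, mul_one] at r0
  have p2 : S ^ 2 = 1024 + 2 * e 2 := by
    linear_combination S * h1 + r0
  have p3 : S ^ 3 = 3070 * e 1 + 6 * e 3 := by
    linear_combination S * p2 + 1024 * h1 + 2 * r1
  have p4 : S ^ 4 = 3143680 + 12272 * e 2 + 24 * e 4 := by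
    linear_combination S * p3 + 3070 * r0 + 6 * r2
  have p5 : S ^ 5 = 15697936 * e 1 + 61320 * e 3 + 120 * e 5 := by
    linear_combination S * p4 + 3143680 * h1 + 12272 * r1 + 24 * r3
  have p6 : S ^ 6 = 16074686464 + 94064912 * e 2 + 367680 * e 4 + 720 * e 6 := by
    linear_combination S * p5 + 15697936 * r0 + 61320 * r2 + 120 * r4
  have p7 : S ^ 7 = 112303091440 * e 1 + 657596016 * e 3 + 2572080 * e 5 + 5040 * e 7 := by
    linear_combination S * p6 + 16074686464 * h1 + 94064912 * r1 + 367680 * r3 + 720 * r5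
  have p8 : S ^ 8 = 114998365634560 + 896669311232 * e 2 + 5253905664 * e 4 + 20563200 * e 6
    + 40320 * e 8 := by
    linear_combination S * p7 + 112303091440 * r0 + 657596016 * r2 + 2572080 * r4 + 5040 * r6
  have p9 : S ^ 9 = 1032291071024896 * e 1 + 8054245616640 * e 3 + 47223429120 * e 5
    + 184947840 * e 7 + 362880 * e 9 := by
    linear_combination S * p8 + 114998365634560 * h1 + 896669311232 * r1 + 5253905664 * r3
      + 20563200 * r5 + 40320 * r7
  have p10 : S ^ 10 = 1057066056729493504 + 10296021162255872 * e 2 + 80384880168960 * e 4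
    + 471617475840 * e 6 + 1848268800 * e 8 + 3628800 * e 10 := by
    linear_combination S * p9 + 1032291071024896 * r0 + 8054245616640 * r2 + 47223429120 * r4
      + 184947840 * r6 + 362880 * r8
  linear_combination (79297981186048) * p2 + (-162974924800) * p4 + (89518080) * p6
    + (-17572) * p8 + p10

lemma exists_hd_quadFun_le (f : BF 10) : ∃ p : QuadCoeff 10, hd f (quadFun p) ≤ 460 := by
  classical
  by_contra! hcon
  set s : QuadCoeff 10 → (Fin 10 → ZMod 2) → ℤ := fun p x => sgn (f x + quadFun p x) with hs
  set E : QuadCoeff 10 → ℕ → ℤ := fun p k => elemSymm (s p) k with hE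
  have hupper : ∀ p, ∑ x, s p x ≤ 102 := by
    intro p
    have h1 := hcon p
    have h2 := sum_sgn_add_eq f (quadFun p)
    simp only [hs]
    rw [h2]
    omega
  have hlower : ∀ p, -102 ≤ ∑ x, s p x := by
    intro p
    have h1 := hupper (p + (0, 0, 1))
    have h2 : ∀ x, s (p + (0, 0, 1)) x = -s p x := by
      intro x
      have h3 : quadFun ((0, 0, 1) : QuadCoeff 10) x = 1 := by simp [quadFun]
      simp only [hs, quadFun_add, h3, ← add_assoc]
      rw [sgn_add _ 1, show sgn 1 = -1 by decide]
      ring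
    simp only [h2, Finset.sum_neg_distrib] at h1
    linarith
  have hexp := fun p => polynomial_expansion (∑ x, s p x) (E p) (by simp [hE, elemSymm])
    (by simp [hE, elemSymm, Finset.powersetCard_one]) (fun k => by
      have := sum_mul_elemSymm (s := s p) (fun x => sgn_mul_self _) k
      simpa using this)
  have hnonpos : ∀ p, ((∑ x, s p x) ^ 4 - 3584 * (∑ x, s p x) ^ 2 + 1048576) ^ 2
      * ((∑ x, s p x) ^ 2 - 10404) ≤ 0 := by
    intro p
    refine mul_nonpos_of_nonneg_of_nonpos (sq_nonneg _) ?_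
    nlinarith [hupper p, hlower p]
  have hsum := Finset.sum_nonpos fun p (_ : p ∈ Finset.univ) => hnonpos p
  simp only [hexp, Finset.sum_add_distrib, ← Finset.mul_sum, Finset.sum_const, Finset.card_univ,
    nsmul_eq_mul] at hsum
  have z : ∀ k, k ≠ 0 → (k < 8 ∨ k = 10) → ∑ p, E p k = 0 :=
    fun k h0 hk => sum_elemSymm_sgn_eq_zero f h0 hk
  rw [z 2 (by norm_num) (by norm_num), z 4 (by norm_num) (by norm_num),
    z 6 (by norm_num) (by norm_num), z 10 (by norm_num) (by norm_num),
    show ∑ p, E p 8 = _ from sum_elemSymm_sgn f 8] at hsum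
  have hlow := cube_sum_lower_bound (g := fun x => sgn (f x)) (fun x => sgn_mul_self _)
  have hpos : (0 : ℤ) < Fintype.card (QuadCoeff 10) := by exact_mod_cast Fintype.card_pos
  generalize (∑ A ∈ (Finset.univ.powersetCard 8).filter QOrth, ∏ x ∈ A, sgn (f x)) = P at hsum hlow
  generalize (Fintype.card (QuadCoeff 10) : ℤ) = c at hsum hpos
  have hP : 0 < 32710646822141952 + 1139765760 * P := by
    norm_num at hlow
    linarith
  nlinarith [mul_pos hpos hP]

end Bound

/-- For every `f ∈ B_10`, `nl_2(f) ≤ 460`. -/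
theorem stmt3 : ∀ f : BF 10, nl 2 f ≤ 460 := by
  intro f
  obtain ⟨p, hp⟩ := exists_hd_quadFun_le f
  have h : nl 2 f ≤ hd f (quadFun p) := Nat.sInf_le ⟨quadFun p, quadFun_mem_RM p, rfl⟩
  exact h.trans hp
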